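/- Let n ≥ 1 and let f : [0,1]^n → ℝ be a continuous function. Then there exist continuous functions Φ_q : ℝ → ℝ for q = 1, …, 2n+1 and continuous functions φ_{q,p} : [0,1] → ℝ for q = 1, …, 2n+1 and p = 1, …, n, such that for every x = (x_1, …, x_n) ∈ [0,1]^n, f(x) = ∑_{q=1}^{2n+1} Φ_q( ∑_{p=1}^{n} φ_{q,p}(x_p) ). -/

import Mathlib

open unitInterval

/-- A bounded continuous function with prescribed values at finitely many points. -/
theorem exists_boundedContinuousFunction_interpolating {ι : Type*} [DecidableEq ι] (s : Finset ι)
    (y v : ι → ℝ) (hy : Set.InjOn y s) {B : ℝ} (hB : 0 ≤ B) (hv : ∀ i ∈ s, |v i| ≤ B) :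
    ∃ Φ : BoundedContinuousFunction ℝ ℝ, ‖Φ‖ ≤ B ∧ ∀ i ∈ s, Φ (y i) = v i := by
  have hbd : ∀ z : ℝ, ‖max (-B) (min B ((Lagrange.interpolate s y v).eval z))‖ ≤ B := by
    intro z
    rw [Real.norm_eq_abs, abs_le]
    exact ⟨le_max_left _ _, max_le (by linarith) (min_le_left _ _)⟩
  refine ⟨BoundedContinuousFunction.ofNormedAddCommGroup
    (fun z => max (-B) (min B ((Lagrange.interpolate s y v).eval z))) (by fun_prop) B hbd,
    (BoundedContinuousFunction.norm_le hB).2 hbd, fun i hi => ?_⟩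
  have h := abs_le.1 (hv i hi)
  change max (-B) (min B ((Lagrange.interpolate s y v).eval (y i))) = v i
  rw [Lagrange.eval_interpolate_at_node v hy hi, min_eq_right h.2, max_eq_right h.1]

/-- A small generic perturbation makes the sum over coordinates injective on a finite grid. -/
theorem exists_perturbation_injOn {n : ℕ} (F : Finset I) (a : Fin n → I → ℝ) {η : ℝ}
    (hη : 0 < η) :
    ∃ τ : ℝ, 0 < τ ∧ τ < η ∧
      Set.InjOn (fun u : Fin n → I => ∑ p, (a p (u p) + τ ^ ((p : ℕ) + 1) * (u p : ℝ)))
        (Fintype.piFinset fun _ : Fin n => F) := by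
  classical
  let P : (Fin n → I) × (Fin n → I) → Polynomial ℝ := fun w =>
    Polynomial.C (∑ p, (a p (w.1 p) - a p (w.2 p))) +
      ∑ p : Fin n, Polynomial.C ((w.1 p : ℝ) - w.2 p) * Polynomial.X ^ ((p : ℕ) + 1)
  have hP : ∀ w, w.1 ≠ w.2 → P w ≠ 0 := by
    intro w hw h0
    apply hw
    funext p
    have h := congrArg (fun Q : Polynomial ℝ => Q.coeff ((p : ℕ) + 1)) h0
    simp only [P, Polynomial.coeff_add, Polynomial.finsetSum_coeff, Polynomial.coeff_C_mul_X_pow,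
      Polynomial.coeff_C_succ, Polynomial.coeff_zero, zero_add, add_left_inj, Fin.val_inj,
      Finset.sum_ite_eq, Finset.mem_univ, if_true] at h
    exact Subtype.ext (by linarith)
  let Z : Finset ℝ := ((Fintype.piFinset fun _ : Fin n => F) ×ˢ
    (Fintype.piFinset fun _ : Fin n => F)).biUnion fun w => (P w).roots.toFinset
  obtain ⟨τ, hτ, hτZ⟩ := (Set.Ioo_infinite hη).exists_notMem_finset Z
  refine ⟨τ, hτ.1, hτ.2, fun u hu u' hu' huu => ?_⟩
  by_contra hne
  refine hτZ (Finset.mem_biUnion.2 ⟨(u, u'), Finset.mem_product.2 ⟨hu, hu'⟩, ?_⟩)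
  rw [Multiset.mem_toFinset, Polynomial.mem_roots (hP _ hne), Polynomial.IsRoot]
  simp only [P, Polynomial.eval_add, Polynomial.eval_C, Polynomial.eval_finsetSum,
    Polynomial.eval_mul, Polynomial.eval_pow, Polynomial.eval_X]
  have h := sub_eq_zero.2 huu
  rw [← Finset.sum_sub_distrib] at h
  rw [← Finset.sum_add_distrib, ← h]
  exact Finset.sum_congr rfl fun p _ => by ring

/-- A continuous staircase: equal to `⌊t⌋` except when `t` is within `1 / m` below an integer. -/
theorem exists_continuous_staircase (m : ℕ) (hm : 0 < m) :
    ∃ R : ℝ → ℝ, Continuous R ∧ (∀ t, |R t - t| ≤ 1) ∧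
      ∀ t, R t ≠ ⌊t⌋ → 1 - 1 / (m : ℝ) < Int.fract t := by
  have hm1 : (1 : ℝ) ≤ m := by exact_mod_cast hm
  let h : ℝ → ℝ := fun s => max 0 (1 - m * (1 - s)) - s
  refine ⟨fun t => t + h (Int.fract t), ?_, fun t => ?_, fun t ht => ?_⟩
  · refine continuous_id.add (ContinuousOn.comp_fract'' (f := h) ?_ ?_)
    · exact Continuous.continuousOn (by fun_prop)
    · simp [h, hm1]
  · have h0 := Int.fract_nonneg t
    have h1 := (Int.fract_lt_one t).le
    rw [add_sub_cancel_left, abs_le]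
    constructor
    · have := le_max_left 0 (1 - m * (1 - Int.fract t))
      simp only [h]; linarith
    · have : max 0 (1 - m * (1 - Int.fract t)) ≤ 1 := max_le zero_le_one (by nlinarith)
      simp only [h]; linarith
  · by_contra! hle
    apply ht
    have : 1 - m * (1 - Int.fract t) ≤ 0 := by
      have h2 : (m : ℝ) * (1 / m) ≤ m * (1 - Int.fract t) := by gcongr; linarith
      rw [mul_one_div_cancel (by positivity)] at h2
      linarith
    simp only [h, max_eq_left this]
    linarith [Int.floor_add_fract t]

/-- Continuous approximations of the identity of `[0,1]` by maps that take values in a fixed finite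
set, except that at each point one of them may fail to do so. -/
theorem exists_approx_id_mem_finset (m : ℕ) (hm : 0 < m) {δ : ℝ} (hδ : 0 < δ) :
    ∃ (F : Finset I) (r : Fin m → C(I, I)), (∀ q x, dist (r q x) x < δ) ∧
      ∀ x q q', r q x ∉ F → r q' x ∉ F → q = q' := by
  classical
  have hm0 : (0 : ℝ) < m := by exact_mod_cast hm
  obtain ⟨R, hRc, hRd, hRf⟩ := exists_continuous_staircase m hm
  obtain ⟨N, hN⟩ := exists_nat_gt (2 / δ)
  have hN0 : (0 : ℝ) < N := lt_trans (by positivity) hN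
  let pr : ℝ → I := Set.projIcc 0 1 zero_le_one
  have hpr : Continuous pr := continuous_projIcc
  let t : Fin m → I → ℝ := fun q x => N * (x : ℝ) - (q : ℕ) / m
  have hq : ∀ q : Fin m, (0 : ℝ) ≤ (q : ℕ) / m ∧ ((q : ℕ) / m : ℝ) ≤ 1 := fun q =>
    ⟨by positivity, (div_le_one hm0).2 (by exact_mod_cast q.2.le)⟩
  let r : Fin m → C(I, I) := fun q => ⟨fun x => pr (R (t q x) / N), by
    simp only [t]; fun_prop⟩
  let F : Finset I := (Finset.Icc (-1 : ℤ) N).image fun k : ℤ => pr (k / N)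
  have hbad : ∀ q x, r q x ∉ F → 1 - 1 / (m : ℝ) < Int.fract (t q x) := by
    intro q x hx
    refine hRf _ fun heq => hx ?_
    refine Finset.mem_image.2 ⟨⌊t q x⌋, Finset.mem_Icc.2 ⟨?_, ?_⟩, ?_⟩
    · rw [Int.le_floor]
      have : 0 ≤ N * (x : ℝ) := mul_nonneg hN0.le x.2.1
      push_cast
      linarith [(hq q).2]
    · have h : (⌊t q x⌋ : ℝ) ≤ N := by
        have : N * (x : ℝ) ≤ N := mul_le_of_le_one_right hN0.le x.2.2
        linarith [(hq q).1, Int.floor_le (t q x)]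
      exact_mod_cast h
    · change _ = pr (R (t q x) / N)
      rw [heq]
  have hlt : ∀ (x : I) (q q' : Fin m), q < q' → r q x ∉ F → r q' x ∉ F → False := by
    intro x q q' hqq h h'
    have h1 := hbad q x h
    have h2 := hbad q' x h'
    have h3 := Int.fract_lt_one (t q x)
    have h4 := Int.fract_lt_one (t q' x)
    have hd : t q x - t q' x = ((q' : ℕ) - (q : ℕ) : ℝ) / m := by simp only [t]; ring
    have hlow : 1 / (m : ℝ) ≤ t q x - t q' x := by
      rw [hd]
      gcongr
      have : ((q : ℕ) : ℝ) + 1 ≤ (q' : ℕ) := by exact_mod_cast hqq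
      linarith
    have hup : t q x - t q' x ≤ 1 - 1 / (m : ℝ) := by
      rw [hd, one_sub_div hm0.ne']
      refine div_le_div_of_nonneg_right ?_ hm0.le
      have : ((q' : ℕ) : ℝ) + 1 ≤ m := by exact_mod_cast q'.2
      have : (0 : ℝ) ≤ (q : ℕ) := Nat.cast_nonneg _
      linarith
    have e1 := Int.floor_add_fract (t q x)
    have e2 := Int.floor_add_fract (t q' x)
    have k0 : (0 : ℝ) < ((⌊t q x⌋ - ⌊t q' x⌋ : ℤ) : ℝ) := by push_cast; linarith
    have k1 : ((⌊t q x⌋ - ⌊t q' x⌋ : ℤ) : ℝ) < 1 := by push_cast; linarith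
    have k0' : 0 < ⌊t q x⌋ - ⌊t q' x⌋ := by exact_mod_cast k0
    have k1' : ⌊t q x⌋ - ⌊t q' x⌋ < 1 := by exact_mod_cast k1
    omega
  refine ⟨F, r, fun q x => ?_, fun x q q' h h' => ?_⟩
  · have h1 : dist (r q x) x ≤ |R (t q x) / N - x| := by
      have := (LipschitzWith.projIcc (zero_le_one (α := ℝ))).dist_le_mul (R (t q x) / N) x
      simpa [Real.dist_eq, pr, r] using this
    have h2 : |R (t q x) / N - x| ≤ 2 / N := by
      have : R (t q x) / N - x = ((R (t q x) - t q x) - (q : ℕ) / m) / N := by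
        simp only [t]; field_simp; ring
      rw [this, abs_div, abs_of_pos hN0]
      gcongr
      have h3 := abs_le.1 (hRd (t q x))
      rw [abs_le]
      constructor <;> linarith [(hq q).1, (hq q).2]
    have h3 : 2 / (N : ℝ) < δ := by
      rw [div_lt_comm₀ hN0 hδ]; exact hN
    linarith
  · rcases lt_trichotomy q q' with hc | hc | hc
    · exact (hlt x q q' hc h h').elim
    · exact hc
    · exact (hlt x q' q hc h' h).elim

/-- A continuous additive map is surjective if every vector can be approximated up to a fixed
proportion of its norm by the image of a vector of comparable norm. -/
theorem surjective_of_approx {E G : Type*} [NormedAddCommGroup E] [CompleteSpace E]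
    [NormedAddCommGroup G] (L : E →+ G) (hL : Continuous L) {C θ : ℝ} (hθ0 : 0 ≤ θ) (hθ : θ < 1)
    (h : ∀ y, ∃ x, ‖x‖ ≤ C * ‖y‖ ∧ ‖y - L x‖ ≤ θ * ‖y‖) : Function.Surjective L := by
  intro y
  choose s hs hs' using h
  have hC : ∀ y : G, C * ‖y‖ ≤ |C| * ‖y‖ := fun y =>
    mul_le_mul_of_nonneg_right (le_abs_self C) (norm_nonneg y)
  let z : ℕ → G := fun k => (fun w => w - L (s w))^[k] y
  have hz : ∀ k, z (k + 1) = z k - L (s (z k)) := fun k => Function.iterate_succ_apply' _ _ _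
  have hzb : ∀ k, ‖z k‖ ≤ θ ^ k * ‖y‖ := by
    intro k
    induction k with
    | zero => simp [z]
    | succ k ih =>
      rw [hz, pow_succ', mul_assoc]
      exact (hs' _).trans (by gcongr)
  have hsum : Summable fun k => s (z k) := by
    refine Summable.of_norm_bounded (g := fun k => |C| * ‖y‖ * θ ^ k)
      ((summable_geometric_of_lt_one hθ0 hθ).mul_left _) fun k => ?_
    calc ‖s (z k)‖ ≤ |C| * ‖z k‖ := (hs _).trans (hC _)
      _ ≤ |C| * (θ ^ k * ‖y‖) := by gcongr; exact hzb k
      _ = |C| * ‖y‖ * θ ^ k := by ring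
  refine ⟨∑' k, s (z k), ?_⟩
  have h1 := (hsum.hasSum.map L hL).tendsto_sum_nat
  have h2 : ∀ N, ∑ k ∈ Finset.range N, (L ∘ fun k => s (z k)) k = y - z N := by
    intro N
    have : ∀ k, (L ∘ fun k => s (z k)) k = z k - z (k + 1) := fun k => by simp [hz]
    simp only [this, Finset.sum_range_sub']
    simp [z]
  simp only [h2] at h1
  have h3 : Filter.Tendsto z Filter.atTop (nhds 0) := by
    refine squeeze_zero_norm hzb ?_
    simpa using (tendsto_pow_atTop_nhds_zero_of_lt_one hθ0 hθ).mul_const ‖y‖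
  have h4 := (tendsto_const_nhds (x := y)).sub h3
  rw [sub_zero] at h4
  exact tendsto_nhds_unique h1 h4

open BoundedContinuousFunction in
/-- The superposition `x ↦ ∑ q, Φ q (∑ p, φ q p (x p))`, additive in the outer functions `Φ`. -/
noncomputable def superposition {m n : ℕ} (φ : Fin m → Fin n → C(I, ℝ)) :
    (Fin m → ℝ →ᵇ ℝ) →+ C(Fin n → I, ℝ) where
  toFun Φ := ∑ q, (Φ q).toContinuousMap.comp
    (∑ p, (φ q p).comp (ContinuousMap.mk fun x : Fin n → I => x p))
  map_zero' := by
    ext x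
    simp
  map_add' Φ Ψ := by
    ext x
    simp [Finset.sum_add_distrib]

open BoundedContinuousFunction in
@[simp] theorem superposition_apply {m n : ℕ} (φ : Fin m → Fin n → C(I, ℝ)) (Φ : Fin m → ℝ →ᵇ ℝ)
    (x : Fin n → I) : superposition φ Φ x = ∑ q, Φ q (∑ p, φ q p (x p)) := by
  simp [superposition]

open BoundedContinuousFunction in
theorem continuous_superposition_inner {m n : ℕ} (Φ : Fin m → ℝ →ᵇ ℝ) :
    Continuous fun φ : Fin m → Fin n → C(I, ℝ) => superposition φ Φ := by
  change Continuous fun φ : Fin m → Fin n → C(I, ℝ) => ∑ q, (Φ q).toContinuousMap.comp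
    (∑ p, (φ q p).comp (ContinuousMap.mk fun x : Fin n → I => x p))
  refine continuous_finsetSum _ fun q _ => ?_
  refine (ContinuousMap.continuous_postcomp (Φ q).toContinuousMap).comp ?_
  refine continuous_finsetSum _ fun p _ => ?_
  exact (ContinuousMap.continuous_precomp _).comp
    ((continuous_apply p).comp (continuous_apply q))

theorem continuous_superposition_outer {m n : ℕ} (φ : Fin m → Fin n → C(I, ℝ)) :
    Continuous (superposition φ) := by
  refine AddMonoidHomClass.continuous_of_bound (superposition φ) m fun Φ => ?_
  refine (ContinuousMap.norm_le _ (by positivity)).2 fun x => ?_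
  rw [superposition_apply]
  refine (norm_sum_le _ _).trans ?_
  have h : ∀ q ∈ Finset.univ, ‖Φ q (∑ p, φ q p (x p))‖ ≤ ‖Φ‖ := fun q _ =>
    ((Φ q).norm_coe_le_norm _).trans (norm_le_pi_norm Φ q)
  simpa using Finset.sum_le_sum h

/-- Error estimate for an average over `n + 1` out of `2 * n + 1` terms, with all terms but at most
`n` close to `c / (n + 1)` and the others bounded. -/
theorem abs_sub_sum_le_of_card_le {n : ℕ} (w : Fin (2 * n + 1) → ℝ) (B : Finset (Fin (2 * n + 1)))
    (hB : B.card ≤ n) {c M ε : ℝ} (hε : 0 ≤ ε) (hc : |c| ≤ M)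
    (hgood : ∀ q ∉ B, |c / (n + 1) - w q| ≤ ε / (n + 1)) (hbad : ∀ q, |w q| ≤ M / (n + 1)) :
    |c - ∑ q, w q| ≤ n / (n + 1) * M + 2 * ε := by
  have hn : (0 : ℝ) < n + 1 := by positivity
  have hBn : (B.card : ℝ) ≤ n := by exact_mod_cast hB
  have hcard : (Bᶜ.card : ℝ) = 2 * n + 1 - B.card := by
    have h := Finset.card_add_card_compl B
    rw [Fintype.card_fin] at h
    have h' : (B.card : ℝ) + Bᶜ.card = 2 * n + 1 := by exact_mod_cast h
    linarith
  have h1 : c - ∑ q, w q = (∑ q ∈ Bᶜ, (c / (n + 1) - w q)) - (∑ q ∈ B, w q) -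
      (n - B.card) / (n + 1) * c := by
    rw [← Finset.sum_add_sum_compl B, Finset.sum_sub_distrib, Finset.sum_const, nsmul_eq_mul, hcard]
    field_simp
    ring
  have h2 : |∑ q ∈ Bᶜ, (c / (n + 1) - w q)| ≤ 2 * ε := by
    refine (Finset.abs_sum_le_sum_abs _ _).trans ?_
    refine (Finset.sum_le_card_nsmul _ _ _ fun q hq => hgood q (Finset.mem_compl.1 hq)).trans ?_
    rw [nsmul_eq_mul, hcard, mul_div_assoc', div_le_iff₀ hn]
    have : (0 : ℝ) ≤ B.card := Nat.cast_nonneg _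
    nlinarith
  have h3 : |∑ q ∈ B, w q| ≤ B.card * (M / (n + 1)) := by
    refine (Finset.abs_sum_le_sum_abs _ _).trans ?_
    simpa using Finset.sum_le_card_nsmul B _ _ fun q _ => hbad q
  have h4 : |(n - B.card) / (n + 1) * c| ≤ (n - B.card) / (n + 1) * M := by
    rw [abs_mul, abs_of_nonneg (div_nonneg (sub_nonneg.2 hBn) hn.le)]
    exact mul_le_mul_of_nonneg_left hc (div_nonneg (sub_nonneg.2 hBn) hn.le)
  have h5 : (B.card : ℝ) * (M / (n + 1)) + (n - B.card) / (n + 1) * M = n / (n + 1) * M := by ring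
  rw [h1]
  have h6 := abs_sub (∑ q ∈ Bᶜ, (c / (n + 1) - w q)) (∑ q ∈ B, w q)
  have h7 := abs_sub ((∑ q ∈ Bᶜ, (c / (n + 1) - w q)) - ∑ q ∈ B, w q) ((n - B.card) / (n + 1) * c)
  linarith

open BoundedContinuousFunction in
/-- Inner functions admitting a good superposition approximation of `f` are dense. -/
theorem exists_dist_lt_superposition_approx {n : ℕ} (f : C(Fin n → I, ℝ))
    (φ : Fin (2 * n + 1) → Fin n → C(I, ℝ)) {η ε : ℝ} (hη : 0 < η) (hε : 0 < ε) :
    ∃ φ' : Fin (2 * n + 1) → Fin n → C(I, ℝ), dist φ' φ < η ∧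
      ∃ Φ : Fin (2 * n + 1) → ℝ →ᵇ ℝ, ‖Φ‖ ≤ ‖f‖ ∧
        ‖f - superposition φ' Φ‖ ≤ n / (n + 1) * ‖f‖ + 2 * ε := by
  classical
  have hn : (0 : ℝ) < n + 1 := by positivity
  obtain ⟨δ₁, hδ₁, hf⟩ := Metric.uniformContinuous_iff.1
    (CompactSpace.uniformContinuous_of_continuous f.continuous) ε hε
  have hφu : UniformContinuous fun (x : I) (q : Fin (2 * n + 1)) (p : Fin n) => φ q p x :=
    CompactSpace.uniformContinuous_of_continuous (by fun_prop)
  obtain ⟨δ₂, hδ₂, hφ⟩ := Metric.uniformContinuous_iff.1 hφu (η / 4) (by positivity)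
  obtain ⟨F, r, hr, hrF⟩ := exists_approx_id_mem_finset (2 * n + 1) (by omega) (lt_min hδ₁ hδ₂)
  have hτ := fun q => exists_perturbation_injOn F (fun p x => φ q p x)
    (lt_min one_pos (by positivity : 0 < η / 4))
  choose τ hτ0 hτη hinj using hτ
  have hval := fun q => exists_boundedContinuousFunction_interpolating
    (Fintype.piFinset fun _ : Fin n => F) _ (fun u => f u / (n + 1)) (hinj q)
    (B := ‖f‖ / (n + 1)) (by positivity) (fun u _ => by
      rw [abs_div, abs_of_pos hn]
      gcongr
      exact f.norm_coe_le_norm u)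
  choose Φ hΦ hΦv using hval
  let φ' : Fin (2 * n + 1) → Fin n → C(I, ℝ) := fun q p =>
    ⟨fun x => φ q p (r q x) + τ q ^ ((p : ℕ) + 1) * (r q x : ℝ), by fun_prop⟩
  refine ⟨φ', ?_, Φ, ?_, ?_⟩
  · have hη2 : 0 ≤ η / 2 := by positivity
    refine lt_of_le_of_lt ?_ (half_lt_self hη)
    refine (dist_pi_le_iff hη2).2 fun q => (dist_pi_le_iff hη2).2 fun p =>
      (ContinuousMap.dist_le hη2).2 fun x => ?_
    have h1 : dist (φ q p (r q x)) (φ q p x) < η / 4 :=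
      (dist_pi_lt_iff (by positivity)).1 ((dist_pi_lt_iff (by positivity)).1
        (hφ ((hr q x).trans_le (min_le_right _ _))) q) p
    have h2 : τ q ^ ((p : ℕ) + 1) * (r q x : ℝ) ≤ η / 4 :=
      calc τ q ^ ((p : ℕ) + 1) * (r q x : ℝ) ≤ τ q ^ ((p : ℕ) + 1) :=
            mul_le_of_le_one_right (pow_nonneg (hτ0 q).le _) (r q x).2.2
        _ ≤ τ q := pow_le_of_le_one (hτ0 q).le ((hτη q).le.trans (min_le_left _ _)) (by omega)
        _ ≤ η / 4 := (hτη q).le.trans (min_le_right _ _)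
    have h3 : 0 ≤ τ q ^ ((p : ℕ) + 1) * (r q x : ℝ) :=
      mul_nonneg (pow_nonneg (hτ0 q).le _) (r q x).2.1
    rw [Real.dist_eq, abs_lt] at h1
    change dist (φ q p (r q x) + τ q ^ ((p : ℕ) + 1) * (r q x : ℝ)) (φ q p x) ≤ η / 2
    rw [Real.dist_eq, abs_le]
    constructor <;> linarith
  · refine (pi_norm_le_iff_of_nonneg (norm_nonneg f)).2 fun q => (hΦ q).trans ?_
    exact div_le_self (norm_nonneg f) (by linarith [(Nat.cast_nonneg n : (0 : ℝ) ≤ n)])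
  · refine (ContinuousMap.norm_le _ (by positivity)).2 fun x => ?_
    rw [ContinuousMap.sub_apply, superposition_apply, Real.norm_eq_abs]
    let B : Finset (Fin (2 * n + 1)) :=
      Finset.univ.biUnion fun p : Fin n => Finset.univ.filter fun q => r q (x p) ∉ F
    have hB : B.card ≤ n := by
      have h := Finset.card_biUnion_le_card_mul (Finset.univ : Finset (Fin n))
        (fun p => Finset.univ.filter fun q => r q (x p) ∉ F) 1 fun p _ =>
          Finset.card_le_one.2 fun q hq q' hq' =>
            hrF (x p) q q' (Finset.mem_filter.1 hq).2 (Finset.mem_filter.1 hq').2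
      simpa using h
    refine abs_sub_sum_le_of_card_le _ B hB hε.le (f.norm_coe_le_norm x) (fun q hq => ?_)
      fun q => ((Φ q).norm_coe_le_norm _).trans (hΦ q)
    have hu : ∀ p, r q (x p) ∈ F := fun p => by
      by_contra hp
      exact hq (Finset.mem_biUnion.2
        ⟨p, Finset.mem_univ _, Finset.mem_filter.2 ⟨Finset.mem_univ _, hp⟩⟩)
    have h1 : Φ q (∑ p, φ' q p (x p)) = f (fun p => r q (x p)) / (n + 1) :=
      hΦv q (fun p => r q (x p)) (Fintype.mem_piFinset.2 hu)
    rw [h1, ← sub_div, abs_div, abs_of_pos hn]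
    gcongr
    have h2 : dist (fun p => r q (x p)) x < δ₁ :=
      (dist_pi_lt_iff hδ₁).2 fun p => (hr q (x p)).trans_le (min_le_left _ _)
    have h3 := hf h2
    rw [dist_comm, Real.dist_eq] at h3
    exact h3.le

open BoundedContinuousFunction in
/-- There are inner functions that work for all continuous functions on the cube at once. -/
theorem exists_superposition_surjective (n : ℕ) :
    ∃ φ : Fin (2 * n + 1) → Fin n → C(I, ℝ), Function.Surjective (superposition φ) := by
  have hn : (0 : ℝ) < n + 1 := by positivity
  obtain ⟨θ, hθn, hθ1⟩ : ∃ θ : ℝ, (n : ℝ) / (n + 1) < θ ∧ θ < 1 :=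
    exists_between ((div_lt_one hn).2 (by linarith))
  have hθ0 : 0 ≤ θ := le_trans (by positivity) hθn.le
  let U : C(Fin n → I, ℝ) → Set (Fin (2 * n + 1) → Fin n → C(I, ℝ)) := fun g =>
    {φ | g ≠ 0 → ∃ Φ : Fin (2 * n + 1) → ℝ →ᵇ ℝ, ‖Φ‖ ≤ ‖g‖ ∧ ‖g - superposition φ Φ‖ < θ * ‖g‖}
  have hUo : ∀ g, IsOpen (U g) := by
    intro g
    by_cases hg : g = 0
    · simp [U, hg]
    · have : U g = ⋃ Φ ∈ {Φ : Fin (2 * n + 1) → ℝ →ᵇ ℝ | ‖Φ‖ ≤ ‖g‖},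
          {φ | ‖g - superposition φ Φ‖ < θ * ‖g‖} := by
        ext φ
        simp [U, hg]
      rw [this]
      exact isOpen_biUnion fun Φ _ => isOpen_lt
        (continuous_const.sub (continuous_superposition_inner Φ)).norm continuous_const
  have hUd : ∀ g, Dense (U g) := by
    intro g
    refine Metric.dense_iff.2 fun φ η hη => ?_
    by_cases hg : g = 0
    · exact ⟨φ, Metric.mem_ball_self hη, fun h => (h hg).elim⟩
    have hg0 : 0 < ‖g‖ := norm_pos_iff.2 hg
    have hε : 0 < (θ - n / (n + 1)) * ‖g‖ := mul_pos (sub_pos.2 hθn) hg0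
    obtain ⟨φ', hd, Φ, hΦ, hΦ'⟩ := exists_dist_lt_superposition_approx g φ hη
      (by positivity : 0 < (θ - n / (n + 1)) * ‖g‖ / 4)
    exact ⟨φ', hd, fun _ => ⟨Φ, hΦ, by linarith⟩⟩
  obtain ⟨g, hg⟩ := TopologicalSpace.exists_dense_seq C(Fin n → I, ℝ)
  have : BaireSpace (Fin (2 * n + 1) → Fin n → C(I, ℝ)) :=
    BaireSpace.of_completelyPseudoMetrizable
  obtain ⟨φ, hφ⟩ := (dense_iInter_of_isOpen (fun k => hUo (g k)) fun k => hUd (g k)).nonempty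
  rw [Set.mem_iInter] at hφ
  refine ⟨φ, surjective_of_approx _ (continuous_superposition_outer φ) (C := 2)
    (θ := (1 + θ) / 2) (by linarith) (by linarith) fun f => ?_⟩
  by_cases hf : f = 0
  · exact ⟨0, by simp [hf]⟩
  have hf0 : 0 < ‖f‖ := norm_pos_iff.2 hf
  obtain ⟨k, hk⟩ := hg.exists_dist_lt f (mul_pos (by linarith : 0 < (1 - θ) / 4) hf0)
  rw [dist_eq_norm] at hk
  have hgk : ‖g k‖ ≤ ‖f‖ + ‖f - g k‖ := by
    simpa using norm_sub_le f (f - g k)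
  have hfg : ‖f‖ ≤ ‖f - g k‖ + ‖g k‖ := by
    simpa using norm_add_le (f - g k) (g k)
  have hk0 : g k ≠ 0 := by
    rw [← norm_pos_iff]
    nlinarith
  obtain ⟨Φ, hΦ, hΦ'⟩ := hφ k hk0
  refine ⟨Φ, by nlinarith, ?_⟩
  have h1 : ‖f - superposition φ Φ‖ ≤ ‖f - g k‖ + ‖g k - superposition φ Φ‖ :=
    norm_sub_le_norm_sub_add_norm_sub _ _ _
  have h2 : θ * ‖g k‖ ≤ θ * (‖f‖ + (1 - θ) / 4 * ‖f‖) := by gcongr; linarith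
  nlinarith [mul_pos (sub_pos.2 hθ1) hf0]

/-- **Kolmogorov–Arnold representation theorem.**
Every continuous function `f : [0,1]^n → ℝ` (with `n ≥ 1`) can be written as
`f x = ∑_{q=1}^{2n+1} Φ_q (∑_{p=1}^{n} φ_{q,p} (x_p))` for some continuous
outer functions `Φ_q : ℝ → ℝ` and continuous inner functions `φ_{q,p} : [0,1] → ℝ`. -/
theorem kolmogorov_arnold_representation
    (n : ℕ) (hn : 1 ≤ n)
    (f : (Fin n → Set.Icc (0 : ℝ) 1) → ℝ) (hf : Continuous f) :
    ∃ (Φ : Fin (2 * n + 1) → ℝ → ℝ)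
      (φ : Fin (2 * n + 1) → Fin n → Set.Icc (0 : ℝ) 1 → ℝ),
      (∀ q, Continuous (Φ q)) ∧
      (∀ q p, Continuous (φ q p)) ∧
      ∀ x : Fin n → Set.Icc (0 : ℝ) 1,
        f x = ∑ q : Fin (2 * n + 1), Φ q (∑ p : Fin n, φ q p (x p)) := by
  obtain ⟨φ, hφ⟩ := exists_superposition_surjective n
  obtain ⟨Φ, hΦ⟩ := hφ ⟨f, hf⟩
  refine ⟨fun q => Φ q, fun q p => φ q p, fun q => (Φ q).continuous, fun q p => (φ q p).continuous,
    fun x => ?_⟩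
  rw [← superposition_apply, hΦ]
  rfl
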